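/- arXiv:1710.07402 — 2 statements merged into one kernel-verified Lean document; each statement's English description precedes it below -/
import Mathlib

section
/- Suppose A_l ∈ ℝ^{m×n} are entrywise positive matrices for l ∈ ℕ with A_l → A as l → ∞, and suppose B has no zero row. Then lim_{l→∞} ρ(A_l,B) = ρ(A,B). -/
open Matrix Filter
open scoped ENNReal Topology

/-- `r(A,B,x) = inf{t ∈ [0,∞] : A x ≤ t B x entrywise}`, valued in `ℝ≥0∞`
(the infimum of the empty set being `⊤`). -/
noncomputable def cwR {m n : ℕ} (A B : Matrix (Fin m) (Fin n) ℝ) (x : Fin n → ℝ) : ℝ≥0∞ :=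
  sInf {t : ℝ≥0∞ | ∃ s : ℝ, 0 ≤ s ∧ t = ENNReal.ofReal s ∧
    ∀ i, A.mulVec x i ≤ s * B.mulVec x i}

/-- The Collatz–Wielandt quotient `ρ(A,B) = inf{r(A,B,x) : x > 0 entrywise}`. -/
noncomputable def cwRho {m n : ℕ} (A B : Matrix (Fin m) (Fin n) ℝ) : ℝ≥0∞ :=
  sInf {t : ℝ≥0∞ | ∃ x : Fin n → ℝ, (∀ j, 0 < x j) ∧ t = cwR A B x}

theorem cwRho_lt_iff {m n : ℕ} {A B : Matrix (Fin m) (Fin n) ℝ} {a : ℝ≥0∞} :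
    cwRho A B < a ↔ ∃ x : Fin n → ℝ, (∀ j, 0 < x j) ∧ ∃ s : ℝ, 0 ≤ s ∧ ENNReal.ofReal s < a ∧
      ∀ i, A.mulVec x i ≤ s * B.mulVec x i := by
  unfold cwRho cwR
  rw [sInf_lt_iff]
  constructor
  · rintro ⟨_, ⟨x, hx, rfl⟩, h⟩
    obtain ⟨_, ⟨s, hs, rfl, hle⟩, hsa⟩ := sInf_lt_iff.mp h
    exact ⟨x, hx, s, hs, hsa, hle⟩
  · rintro ⟨x, hx, s, hs, hsa, hle⟩
    exact ⟨_, ⟨x, hx, rfl⟩, sInf_lt_iff.mpr ⟨_, ⟨s, hs, rfl, hle⟩, hsa⟩⟩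

theorem cwRho_le_ofReal {m n : ℕ} {A B : Matrix (Fin m) (Fin n) ℝ} {x : Fin n → ℝ}
    (hx : ∀ j, 0 < x j) {s : ℝ} (hs : 0 ≤ s) (hle : ∀ i, A.mulVec x i ≤ s * B.mulVec x i) :
    cwRho A B ≤ ENNReal.ofReal s :=
  calc cwRho A B ≤ cwR A B x := sInf_le ⟨x, hx, rfl⟩
    _ ≤ ENNReal.ofReal s := sInf_le ⟨s, hs, rfl, hle⟩

theorem mulVec_pos_of_row_ne_zero {m n : ℕ} {B : Matrix (Fin m) (Fin n) ℝ}
    (hB : ∀ i j, 0 ≤ B i j) (hBrow : ∀ i, ∃ j, 0 < B i j) {x : Fin n → ℝ} (hx : ∀ j, 0 < x j)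
    (i : Fin m) : 0 < B.mulVec x i := by
  obtain ⟨j, hj⟩ := hBrow i
  exact Finset.sum_pos' (fun k _ => mul_nonneg (hB i k) (hx k).le)
    ⟨j, Finset.mem_univ j, mul_pos hj (hx j)⟩

/-- If positive matrices `A_l` converge to `A` and `B` has no zero row,
then `ρ(A_l,B) → ρ(A,B)`. -/
theorem stmt8 {m n : ℕ} (hm : 0 < m) (hn : 0 < n)
    (A B : Matrix (Fin m) (Fin n) ℝ)
    (hA : ∀ i j, 0 ≤ A i j) (hB : ∀ i j, 0 ≤ B i j)
    (hBrow : ∀ i, ∃ j, 0 < B i j)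
    (Al : ℕ → Matrix (Fin m) (Fin n) ℝ)
    (hAl : ∀ l i j, 0 < Al l i j)
    (hlim : Tendsto Al atTop (𝓝 A)) :
    Tendsto (fun l => cwRho (Al l) B) atTop (𝓝 (cwRho A B)) := by
  have hentry (i : Fin m) (j : Fin n) : Tendsto (fun l => Al l i j) atTop (𝓝 (A i j)) :=
    tendsto_pi_nhds.mp (tendsto_pi_nhds.mp hlim i) j
  rw [tendsto_order]
  constructor
  · intro a ha
    obtain ⟨b, hb, hab, hbA⟩ := ENNReal.lt_iff_exists_real_btwn.mp ha
    obtain ⟨c, hc, hbc, hcA⟩ := ENNReal.lt_iff_exists_real_btwn.mp hbA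
    have hb0 : 0 < b := ENNReal.ofReal_pos.mp (bot_le.trans_lt hab)
    have hbc' : b < c := (ENNReal.ofReal_lt_ofReal_iff_of_nonneg hb).mp hbc
    have hdom : ∀ᶠ l in atTop, ∀ i j, b * A i j ≤ c * Al l i j := by
      refine eventually_all.mpr fun i => eventually_all.mpr fun j => ?_
      rcases (hA i j).eq_or_lt with h | h
      · exact Eventually.of_forall fun l => by
          rw [← h, mul_zero]
          exact mul_nonneg hc (hAl l i j).le
      · exact (((hentry i j).const_mul c).eventually_const_lt
          (mul_lt_mul_of_pos_right hbc' h)).mono fun _ => le_of_lt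
    filter_upwards [hdom] with l hl
    refine hab.trans_le (not_lt.mp fun hlt => hcA.not_ge ?_)
    obtain ⟨x, hx, s, hs, hsb, hle⟩ := cwRho_lt_iff.mp hlt
    have hsb' : s < b := (ENNReal.ofReal_lt_ofReal_iff_of_nonneg hs).mp hsb
    refine cwRho_le_ofReal hx hc fun i => le_of_mul_le_mul_left ?_ hb0
    have hBx := (mulVec_pos_of_row_ne_zero hB hBrow hx i).le
    calc b * A.mulVec x i ≤ c * (Al l).mulVec x i := by
          simp only [mulVec, dotProduct, Finset.mul_sum, ← mul_assoc]
          exact Finset.sum_le_sum fun j _ => mul_le_mul_of_nonneg_right (hl i j) (hx j).le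
      _ ≤ c * (b * B.mulVec x i) := by
          gcongr
          exact (hle i).trans (by gcongr)
      _ = b * (c * B.mulVec x i) := by ring
  · intro a ha
    obtain ⟨x, hx, s, hs, hsa, hle⟩ := cwRho_lt_iff.mp ha
    obtain ⟨t, ht, hst, hta⟩ := ENNReal.lt_iff_exists_real_btwn.mp hsa
    have hst' : s < t := (ENNReal.ofReal_lt_ofReal_iff_of_nonneg hs).mp hst
    have hmul (i : Fin m) : Tendsto (fun l => (Al l).mulVec x i) atTop (𝓝 (A.mulVec x i)) := by
      simp only [mulVec, dotProduct]
      exact tendsto_finsetSum _ fun j _ => (hentry i j).mul_const (x j)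
    have hev : ∀ᶠ l in atTop, ∀ i, (Al l).mulVec x i < t * B.mulVec x i :=
      eventually_all.mpr fun i => (hmul i).eventually_lt_const <| (hle i).trans_lt <|
        mul_lt_mul_of_pos_right hst' (mulVec_pos_of_row_ne_zero hB hBrow hx i)
    filter_upwards [hev] with l hl
    exact (cwRho_le_ofReal hx ht fun i => (hl i).le).trans_lt hta
end

section
/- Assume ρ̂(A,B) < ∞. Every minimal weakly optimal vector y has at most m positive coordinates, i.e., |supp y| ≤ m. -/
open Matrix
open scoped ENNReal

/-- The weak Collatz–Wielandt quotient `ρ̂(A,B) = inf{r(A,B,x) : x ≥ 0, x ≠ 0}`. -/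
noncomputable def cwRhoHat {m n : ℕ} (A B : Matrix (Fin m) (Fin n) ℝ) : ℝ≥0∞ :=
  sInf {t : ℝ≥0∞ | ∃ x : Fin n → ℝ, (∀ j, 0 ≤ x j) ∧ x ≠ 0 ∧ t = cwR A B x}

/-- The support of a vector: the set of indices of its positive coordinates. -/
def suppS {n : ℕ} (y : Fin n → ℝ) : Set (Fin n) := {j | 0 < y j}

/-- `y` is weakly optimal for the pair `(A,B)`. -/
def WeaklyOptimal {m n : ℕ} (A B : Matrix (Fin m) (Fin n) ℝ) (y : Fin n → ℝ) : Prop :=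
  (∀ j, 0 ≤ y j) ∧ y ≠ 0 ∧ cwR A B y = cwRhoHat A B

/-- `y` is minimal weakly optimal: weakly optimal, and no weakly optimal vector has
support strictly contained in the support of `y`. -/
def MinWeaklyOptimal {m n : ℕ} (A B : Matrix (Fin m) (Fin n) ℝ) (y : Fin n → ℝ) : Prop :=
  WeaklyOptimal A B y ∧ ∀ w : Fin n → ℝ, WeaklyOptimal A B w → ¬ suppS w ⊂ suppS y

open Filter Topology

/-- A feasible scalar bounds `cwR` from above. -/
theorem cwR_le_ofReal {m n : ℕ} {A B : Matrix (Fin m) (Fin n) ℝ} {x : Fin n → ℝ} {s : ℝ}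
    (hs : 0 ≤ s) (h : ∀ i, A.mulVec x i ≤ s * B.mulVec x i) :
    cwR A B x ≤ ENNReal.ofReal s :=
  sInf_le ⟨s, hs, rfl, h⟩

/-- The quotient `ρ̂` is a lower bound of `cwR` on nonzero nonnegative vectors. -/
theorem cwRhoHat_le_cwR {m n : ℕ} (A B : Matrix (Fin m) (Fin n) ℝ) {x : Fin n → ℝ}
    (hx : ∀ j, 0 ≤ x j) (hx0 : x ≠ 0) : cwRhoHat A B ≤ cwR A B x :=
  sInf_le ⟨x, hx, hx0, rfl⟩

theorem mulVec_apply_nonneg {m n : ℕ} {A : Matrix (Fin m) (Fin n) ℝ} {x : Fin n → ℝ}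
    (hA : ∀ i j, 0 ≤ A i j) (hx : ∀ j, 0 ≤ x j) (i : Fin m) : 0 ≤ A.mulVec x i :=
  dotProduct_nonneg_of_nonneg (hA i) hx

/-- The infimum defining a finite `cwR` is attained. -/
theorem mulVec_le_of_cwR_eq {m n : ℕ} {A B : Matrix (Fin m) (Fin n) ℝ} {x : Fin n → ℝ} {r : ℝ}
    (hB : ∀ i j, 0 ≤ B i j) (hx : ∀ j, 0 ≤ x j) (hr : 0 ≤ r)
    (h : cwR A B x = ENNReal.ofReal r) (i : Fin m) :
    A.mulVec x i ≤ r * B.mulVec x i := by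
  have key : ∀ s, r < s → A.mulVec x i ≤ s * B.mulVec x i := by
    intro s hs
    have hlt : cwR A B x < ENNReal.ofReal s := by
      rw [h]
      exact (ENNReal.ofReal_lt_ofReal_iff (hr.trans_lt hs)).2 hs
    obtain ⟨_, ⟨u, -, rfl, hu⟩, hus⟩ := sInf_lt_iff.1 hlt
    have hus' : u < s := (ENNReal.ofReal_lt_ofReal_iff (hr.trans_lt hs)).1 hus
    exact (hu i).trans (mul_le_mul_of_nonneg_right hus'.le (mulVec_apply_nonneg hB hx i))
  have ht : Tendsto (fun s : ℝ => s * B.mulVec x i) (𝓝[>] r) (𝓝 (r * B.mulVec x i)) :=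
    (Continuous.tendsto (by fun_prop) r).mono_left nhdsWithin_le_nhds
  exact ge_of_tendsto ht (eventually_mem_nhdsWithin.mono key)

/-- A nonnegative vector cannot satisfy `A x < ρ̂ B x` strictly in every coordinate. -/
theorem not_forall_mulVec_lt {m n : ℕ} (hm : 0 < m) {A B : Matrix (Fin m) (Fin n) ℝ}
    (hA : ∀ i j, 0 ≤ A i j) (hB : ∀ i j, 0 ≤ B i j) {r : ℝ}
    (h : cwRhoHat A B = ENNReal.ofReal r) {x : Fin n → ℝ} (hx : ∀ j, 0 ≤ x j) :
    ¬ ∀ i, A.mulVec x i < r * B.mulVec x i := by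
  intro hlt
  have hx0 : x ≠ 0 := by
    rintro rfl
    simpa using hlt ⟨0, hm⟩
  have hr : 0 < r :=
    pos_of_mul_pos_left ((mulVec_apply_nonneg hA hx ⟨0, hm⟩).trans_lt (hlt ⟨0, hm⟩))
      (mulVec_apply_nonneg hB hx _)
  have hev : ∀ᶠ s in 𝓝[<] r, ∀ i, A.mulVec x i < s * B.mulVec x i := by
    refine eventually_all.2 fun i => ?_
    have ht : Tendsto (fun s : ℝ => s * B.mulVec x i) (𝓝[<] r) (𝓝 (r * B.mulVec x i)) :=
      (Continuous.tendsto (by fun_prop) r).mono_left nhdsWithin_le_nhds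
    exact ht.eventually_const_lt (hlt i)
  obtain ⟨s, hs, hs0, hsr⟩ := (hev.and (Ioo_mem_nhdsLT hr)).exists
  have hle := (cwRhoHat_le_cwR A B hx hx0).trans (cwR_le_ofReal hs0.le fun i => (hs i).le)
  rw [h, ENNReal.ofReal_le_ofReal_iff hs0.le] at hle
  exact hle.not_gt hsr

/-- A vector subtraction that stays nonnegative and kills a positive coordinate. -/
theorem exists_sub_smul_nonneg {ι : Type*} [Fintype ι] {y z : ι → ℝ} (hy : ∀ j, 0 ≤ y j)
    (hz : ∃ j, 0 < z j) : ∃ (t : ℝ) (k : ι), 0 < z k ∧ y k - t * z k = 0 ∧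
      ∀ j, 0 ≤ y j - t * z j := by
  classical
  obtain ⟨k, hk, hmin⟩ := Finset.exists_min_image (Finset.univ.filter fun j => 0 < z j)
    (fun j => y j / z j) (by simpa [Finset.Nonempty] using hz)
  simp only [Finset.mem_filter, Finset.mem_univ, true_and] at hk hmin
  refine ⟨y k / z k, k, hk, by field_simp; simp, fun j => ?_⟩
  rcases lt_or_ge 0 (z j) with hj | hj
  · have := (le_div_iff₀ hj).1 (hmin j hj)
    linarith
  · have := mul_nonpos_of_nonneg_of_nonpos (div_nonneg (hy k) hk.le) hj
    linarith [hy j]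

/-- A linear map that is not surjective and whose source has larger dimension than its
target vanishes on a nonzero vector in the kernel of any given functional. -/
theorem exists_ne_zero_map_eq_zero_of_not_surjective {V W : Type*} [AddCommGroup V] [Module ℝ V]
    [FiniteDimensional ℝ V] [AddCommGroup W] [Module ℝ W] [FiniteDimensional ℝ W]
    (T : V →ₗ[ℝ] W) (hT : ¬ Function.Surjective T)
    (hd : Module.finrank ℝ W < Module.finrank ℝ V) (f : V →ₗ[ℝ] ℝ) :
    ∃ z, z ≠ 0 ∧ T z = 0 ∧ f z = 0 := by
  have hrange : Module.finrank ℝ T.range < Module.finrank ℝ W :=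
    Submodule.finrank_lt (mt LinearMap.range_eq_top.1 hT)
  have hrk := T.finrank_range_add_finrank_ker
  have hker : (f.comp T.ker.subtype).ker ≠ ⊥ :=
    LinearMap.ker_ne_bot_of_finrank_lt (by rw [Module.finrank_self]; omega)
  obtain ⟨z, hz, hz0⟩ := Submodule.exists_mem_ne_zero_of_ne_bot hker
  exact ⟨z, by simpa using hz0, z.2, hz⟩

/-- If `ρ̂(A,B) < ∞`, a minimal weakly optimal vector has at most `m` positive
coordinates. -/
theorem stmt12 {m n : ℕ} (hm : 0 < m) (hn : 0 < n)
    (A B : Matrix (Fin m) (Fin n) ℝ)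
    (hA : ∀ i j, 0 ≤ A i j) (hB : ∀ i j, 0 ≤ B i j)
    (hfin : cwRhoHat A B < ⊤)
    (y : Fin n → ℝ) (hy : MinWeaklyOptimal A B y) :
    (suppS y).ncard ≤ m := by
  classical
  obtain ⟨⟨hy0, hyne, hyopt⟩, hmin⟩ := hy
  set r := (cwRhoHat A B).toReal
  have hr : 0 ≤ r := ENNReal.toReal_nonneg
  have hρ : cwRhoHat A B = ENNReal.ofReal r := (ENNReal.ofReal_toReal hfin.ne).symm
  have hyle := mulVec_le_of_cwR_eq hB hy0 hr (hyopt.trans hρ)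
  let C : Matrix (Fin m) (Fin n) ℝ := r • B - A
  have hC : ∀ x i, C.mulVec x i = r * B.mulVec x i - A.mulVec x i := fun x i => by
    simp [C, Matrix.sub_mulVec, Matrix.smul_mulVec]
  let E : (suppS y → ℝ) →ₗ[ℝ] (Fin n → ℝ) := Function.ExtendByZero.linearMap ℝ Subtype.val
  have hEin : ∀ v (j : suppS y), E v j = v j := fun v j =>
    Subtype.val_injective.extend_apply v 0 j
  have hEout : ∀ v j, j ∉ suppS y → E v j = 0 := fun v j hj =>
    Function.extend_apply' v (0 : Fin n → ℝ) j fun ⟨k, hk⟩ => hj (hk ▸ k.2)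
  by_contra! hcard
  have hns : ¬ Function.Surjective (C.mulVecLin.comp E) := by
    intro hsurj
    obtain ⟨u, hu⟩ := hsurj 1
    have hu' : ∀ i, C.mulVec (E u) i = 1 := fun i => congrFun hu i
    have hev : ∀ᶠ ε in 𝓝[>] (0 : ℝ), ∀ j, 0 ≤ y j + ε * E u j := by
      refine eventually_all.2 fun j => ?_
      by_cases hj : j ∈ suppS y
      · have ht : Tendsto (fun ε : ℝ => y j + ε * E u j) (𝓝[>] 0) (𝓝 (y j + 0 * E u j)) :=
          (Continuous.tendsto (by fun_prop) 0).mono_left nhdsWithin_le_nhds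
        have hj' : 0 < y j + 0 * E u j := by rwa [zero_mul, add_zero]
        exact (ht.eventually_const_lt hj').mono fun _ => le_of_lt
      · simp [hEout u j hj, hy0 j]
    obtain ⟨ε, hε, hε0⟩ := (hev.and eventually_mem_nhdsWithin).exists
    refine not_forall_mulVec_lt hm hA hB hρ (x := y + ε • E u) hε fun i => ?_
    have hCi : C.mulVec (y + ε • E u) i = C.mulVec y i + ε := by
      simp [Matrix.mulVec_add, Matrix.mulVec_smul, hu']
    have hε0' : 0 < ε := hε0
    rw [hC, hC] at hCi
    linarith [hyle i]
  obtain ⟨j₀, hj₀⟩ : (suppS y).Nonempty :=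
    Set.nonempty_of_ncard_ne_zero (by omega)
  obtain ⟨v, hv, hCv, hvj⟩ := exists_ne_zero_map_eq_zero_of_not_surjective _ hns
    (by rwa [Module.finrank_fin_fun, Module.finrank_fintype_fun_eq_card,
      ← Nat.card_eq_fintype_card, Nat.card_coe_set_eq])
    (LinearMap.proj (⟨j₀, hj₀⟩ : suppS y))
  obtain ⟨z, hCz, hzj, hzout, hzpos⟩ : ∃ z : Fin n → ℝ, C.mulVec z = 0 ∧ z j₀ = 0 ∧
      (∀ j, j ∉ suppS y → z j = 0) ∧ ∃ j, 0 < z j := by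
    have hCv' : C.mulVec (E v) = 0 := hCv
    have hEj : E v j₀ = 0 := (hEin v ⟨j₀, hj₀⟩).trans hvj
    obtain ⟨j, hj⟩ := Function.ne_iff.1 hv
    rcases lt_or_gt_of_ne hj with hj | hj
    · refine ⟨-E v, by rw [Matrix.mulVec_neg, hCv', neg_zero], by simp [hEj],
        fun k hk => by simp [hEout v k hk], j, ?_⟩
      rw [Pi.neg_apply, hEin]
      exact neg_pos.2 hj
    · exact ⟨E v, hCv', hEj, hEout v, j, by rw [hEin]; exact hj⟩
  obtain ⟨t, k, hzk, hwk, hw⟩ := exists_sub_smul_nonneg hy0 hzpos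
  have hw0 : y - t • z ≠ 0 := fun h => by
    have := congrFun h j₀
    simp only [Pi.sub_apply, Pi.smul_apply, hzj, smul_zero, sub_zero, Pi.zero_apply] at this
    exact (ne_of_gt hj₀) this
  have hCw : C.mulVec (y - t • z) = C.mulVec y := by
    rw [Matrix.mulVec_sub, Matrix.mulVec_smul, hCz, smul_zero, sub_zero]
  refine hmin (y - t • z) ⟨hw, hw0, le_antisymm ?_ (cwRhoHat_le_cwR A B hw hw0)⟩ ⟨?_, ?_⟩
  · rw [hρ]
    refine cwR_le_ofReal hr fun i => ?_
    have := congrFun hCw i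
    rw [hC, hC] at this
    linarith [hyle i]
  · intro j hj
    by_contra hjy
    have hyj : y j = 0 := le_antisymm (not_lt.1 hjy) (hy0 j)
    simp [suppS, hzout j hjy, hyj] at hj
  · intro hsub
    have hk : k ∈ suppS y := by
      by_contra hk
      exact hzk.ne' (hzout k hk)
    exact (ne_of_gt (hsub hk)) hwk
end
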